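/- arXiv:2104.09544 — 6 statements merged into one kernel-verified Lean document; each statement's English description precedes it below -/
import Mathlib

section
/- Lemma 1: If l₁ + l₂ > n, then the system cannot be in a state of free movement: for every admissible initial state x(0) and every time t₀, it is not the case that the system is in free movement from time t₀. -/
open Filter

/-! Two-contour Buslaev system with co-directional movement.
Parameters: `n` cells per contour, node 1 between cells `n-1` and `0`,
node 2 between cells `d-1` and `d`; cluster `i` has `lᵢ` particles. -/

/-- A state records the leading cells of clusters 1 and 2. -/
abbrev TCState (n : ℕ) := ZMod n × ZMod n

/-- Cluster with leading cell `x` is at node 1 (i.e. in cell `n-1`). -/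
def AtNode1 (n : ℕ) (x : ZMod n) : Prop := x = (-1 : ZMod n)

/-- Cluster with leading cell `x` is at node 2 (i.e. in cell `d-1`). -/
def AtNode2 (n d : ℕ) (x : ZMod n) : Prop := x = (d : ZMod n) - 1

/-- A cluster of length `l` with leading cell `x` occupies node 1:
`x ∈ {0, 1, …, l-2}` (mod `n`). -/
def OccupiesNode1 (n l : ℕ) (x : ZMod n) : Prop :=
  ∃ k : ℕ, k + 2 ≤ l ∧ x = (k : ZMod n)

/-- A cluster of length `l` with leading cell `x` occupies node 2:
`x ∈ {d, d+1, …, d+l-2}` (mod `n`). -/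
def OccupiesNode2 (n d l : ℕ) (x : ZMod n) : Prop :=
  ∃ k : ℕ, k + 2 ≤ l ∧ x = ((d + k : ℕ) : ZMod n)

/-- Cluster 1 advances from state `x` unless it is at a node occupied by cluster 2. -/
def Moves1 (n d l₂ : ℕ) (x : TCState n) : Prop :=
  ¬ ((AtNode1 n x.1 ∧ OccupiesNode1 n l₂ x.2) ∨
     (AtNode2 n d x.1 ∧ OccupiesNode2 n d l₂ x.2))

/-- Cluster 2 advances from state `x` unless it is at a node occupied by cluster 1,
or both clusters are at the same node (in which case cluster 1 has priority). -/
def Moves2 (n d l₁ : ℕ) (x : TCState n) : Prop :=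
  ¬ ((AtNode1 n x.2 ∧ OccupiesNode1 n l₁ x.1) ∨
     (AtNode2 n d x.2 ∧ OccupiesNode2 n d l₁ x.1) ∨
     (AtNode1 n x.1 ∧ AtNode1 n x.2) ∨
     (AtNode2 n d x.1 ∧ AtNode2 n d x.2))

open Classical in
/-- One step of the dynamics. -/
noncomputable def tcStep (n d l₁ l₂ : ℕ) (x : TCState n) : TCState n :=
  (if Moves1 n d l₂ x then x.1 + 1 else x.1,
   if Moves2 n d l₁ x then x.2 + 1 else x.2)

/-- A state is admissible if no node is occupied by both clusters. -/
def Admissible (n d l₁ l₂ : ℕ) (x : TCState n) : Prop :=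
  ¬ (OccupiesNode1 n l₁ x.1 ∧ OccupiesNode1 n l₂ x.2) ∧
  ¬ (OccupiesNode2 n d l₁ x.1 ∧ OccupiesNode2 n d l₂ x.2)

/-- `traj n d l₁ l₂ x0 t` is the state `x(t)` starting from `x(0) = x0`. -/
noncomputable def traj (n d l₁ l₂ : ℕ) (x0 : TCState n) (t : ℕ) : TCState n :=
  (tcStep n d l₁ l₂)^[t] x0

/-- Free movement from time `t₀`: both clusters advance at every step `t ≥ t₀`. -/
def FreeFrom (n d l₁ l₂ : ℕ) (x0 : TCState n) (t₀ : ℕ) : Prop :=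
  ∀ t, t₀ ≤ t →
    Moves1 n d l₂ (traj n d l₁ l₂ x0 t) ∧ Moves2 n d l₁ (traj n d l₁ l₂ x0 t)

/-- Collapse from time `t₀`: neither cluster advances at any step `t ≥ t₀`. -/
def CollapseFrom (n d l₁ l₂ : ℕ) (x0 : TCState n) (t₀ : ℕ) : Prop :=
  ∀ t, t₀ ≤ t →
    ¬ Moves1 n d l₂ (traj n d l₁ l₂ x0 t) ∧ ¬ Moves2 n d l₁ (traj n d l₁ l₂ x0 t)

open Classical in
/-- `H1`: the number of steps `s < t` at which cluster 1 advances. -/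
noncomputable def H1 (n d l₁ l₂ : ℕ) (x0 : TCState n) (t : ℕ) : ℕ :=
  ((Finset.range t).filter (fun s => Moves1 n d l₂ (traj n d l₁ l₂ x0 s))).card

open Classical in
/-- `H2`: the number of steps `s < t` at which cluster 2 advances. -/
noncomputable def H2 (n d l₁ l₂ : ℕ) (x0 : TCState n) (t : ℕ) : ℕ :=
  ((Finset.range t).filter (fun s => Moves2 n d l₁ (traj n d l₁ l₂ x0 s))).card

/-- Under free movement from time `t₀`, both clusters are translated by the elapsed time. -/
theorem FreeFrom.traj_add {n d l₁ l₂ : ℕ} {x0 : TCState n} {t₀ : ℕ}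
    (h : FreeFrom n d l₁ l₂ x0 t₀) (s : ℕ) :
    traj n d l₁ l₂ x0 (t₀ + s) =
      ((traj n d l₁ l₂ x0 t₀).1 + s, (traj n d l₁ l₂ x0 t₀).2 + s) := by
  induction s with
  | zero => simp
  | succ s ih =>
    have hm := h (t₀ + s) (Nat.le_add_right _ _)
    have hstep : traj n d l₁ l₂ x0 (t₀ + (s + 1)) =
        tcStep n d l₁ l₂ (traj n d l₁ l₂ x0 (t₀ + s)) := by
      rw [← add_assoc]
      exact Function.iterate_succ_apply' _ _ _
    rw [hstep, tcStep, if_pos hm.1, if_pos hm.2, ih]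
    push_cast
    simp only [add_assoc]

/-- Lemma 1: if `l₁ + l₂ > n`, the system cannot be in a state of free movement. -/
theorem lemma1_no_free_movement (n d l₁ l₂ : ℕ)
    (hd : 0 < d) (hdn : 2 * d ≤ n) (hl₁ : 0 < l₁) (hl₁₂ : l₁ ≤ l₂) (hl₂ : l₂ < n)
    (h : n < l₁ + l₂) :
    ∀ x0 : TCState n, Admissible n d l₁ l₂ x0 →
      ∀ t₀ : ℕ, ¬ FreeFrom n d l₁ l₂ x0 t₀ := by
  intro x0 _ t₀ hf
  have : NeZero n := ⟨by omega⟩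
  set a := (traj n d l₁ l₂ x0 t₀).1
  set b := (traj n d l₁ l₂ x0 t₀).2
  have hfree (s : ZMod n) : Moves1 n d l₂ (a + s, b + s) ∧ Moves2 n d l₁ (a + s, b + s) := by
    have hs := hf (t₀ + s.val) (Nat.le_add_right _ _)
    rwa [hf.traj_add, ZMod.natCast_zmod_val] at hs
  obtain ⟨m, hm, hmn⟩ : ∃ m : ℕ, m < n ∧ b - a = m :=
    ⟨(b - a).val, ZMod.val_lt _, (ZMod.natCast_zmod_val _).symm⟩
  have hb' : b = a + m := by rw [← hmn]; ring
  -- cluster 1 meets node 1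
  obtain ⟨h₁, h₁'⟩ := hfree (-1 - a)
  have hm0 : m ≠ 0 := by
    rintro rfl
    refine h₁' (Or.inr (Or.inr (Or.inl ⟨?_, ?_⟩)))
    · simp [AtNode1]
    · simp [AtNode1, hb']
  have hml : l₂ ≤ m := by
    by_contra! hlt
    refine h₁ (Or.inl ⟨by simp [AtNode1], m - 1, by omega, ?_⟩)
    rw [hb', Nat.cast_sub (by omega)]
    push_cast
    ring
  -- cluster 2 meets node 1
  refine (hfree (-1 - b)).2 (Or.inl ⟨by simp [AtNode1], n - m - 1, by omega, ?_⟩)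
  rw [hb', Nat.cast_sub (by omega), Nat.cast_sub (by omega), ZMod.natCast_self]
  push_cast
  ring
end

section
/- Lemma 2: If, starting from an admissible initial state, there is no time t₀ such that the system is in free movement from t₀, and no time t₀ such that the system is in collapse from t₀, then there exist arbitrarily large times t at which x(t) is one of the four states (l₁, 0), (0, l₂), (d+l₁, d), (d, d+l₂) (all coordinates taken modulo n). -/
open Filter

lemma natCast_inj_of_lt {n a b : ℕ} (ha : a < n) (hb : b < n) (h : (a : ZMod n) = b) : a = b := by
  rw [ZMod.natCast_eq_natCast_iff'] at h
  rwa [Nat.mod_eq_of_lt ha, Nat.mod_eq_of_lt hb] at h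

lemma traj_succ (n d l₁ l₂ : ℕ) (x0 : TCState n) (t : ℕ) :
    traj n d l₁ l₂ x0 (t + 1) = tcStep n d l₁ l₂ (traj n d l₁ l₂ x0 t) :=
  Function.iterate_succ_apply' _ _ _

lemma moves1_or_moves2 {n d l₁ l₂ : ℕ} {x0 : TCState n}
    (hcol : ∀ t₀ : ℕ, ¬ CollapseFrom n d l₁ l₂ x0 t₀) (t : ℕ) :
    Moves1 n d l₂ (traj n d l₁ l₂ x0 t) ∨ Moves2 n d l₁ (traj n d l₁ l₂ x0 t) := by
  by_contra! h
  refine hcol t fun s hs => ?_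
  have hfix : traj n d l₁ l₂ x0 s = traj n d l₁ l₂ x0 t := by
    induction s, hs using Nat.le_induction with
    | base => rfl
    | succ s _ ih => rw [traj_succ, ih]; simp [tcStep, h.1, h.2]
  rwa [hfix]

/-- If cluster `i` is blocked at node `c` by the other cluster, then the other cluster keeps moving
until `i` is released, at which time either both clusters move or the other one is blocked. -/
lemma exists_release_or_blocked {n : ℕ} (X : Bool → ℕ → ZMod n) (M : Bool → ℕ → Prop)
    (L : Bool → ℕ) (N : Bool → ZMod n) (hN : Function.Injective N) (hL : ∀ i, L i < n)
    (hmove : ∀ i t, M i t → X i (t + 1) = X i t + 1)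
    (hstay : ∀ i t, ¬ M i t → X i (t + 1) = X i t)
    (hne : ∀ i t, M i t ∨ M (!i) t)
    (hblocked : ∀ i t, ¬ M i t → ∃ c, ∃ m < L (!i), X i t = N c - 1 ∧ X (!i) t = N c - 1 + m)
    (hocc : ∀ i t c m, 1 ≤ m → m < L (!i) → X i t = N c - 1 → X (!i) t = N c - 1 + (m : ℕ) →
      ¬ M i t)
    (i c : Bool) (j : ℕ) : ∀ t m : ℕ, m + j + 1 = L (!i) → ¬ M i t → X i t = N c - 1 →
      X (!i) t = N c - 1 + m →
      ∃ s, t ≤ s ∧ ((X i s = N c ∧ X (!i) s = N c + L (!i)) ∨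
        (¬ M (!i) s ∧ X i s = N c - 1 ∧ X (!i) s = N c - 1 + L (!i))) := by
  induction j with
  | zero =>
    intro t m hm hMi hi hj
    have hi' : X i (t + 1) = N c - 1 := by rw [hstay i t hMi, hi]
    have hj' : X (!i) (t + 1) = N c - 1 + L (!i) := by
      rw [hmove (!i) t ((hne i t).resolve_left hMi), hj, ← hm]
      push_cast
      ring
    have hMi' : M i (t + 1) := by
      by_contra h
      obtain ⟨c', m', hm', h1, h2⟩ := hblocked i (t + 1) h
      obtain rfl : c = c' := hN (sub_left_injective (hi'.symm.trans h1))
      have := natCast_inj_of_lt (hL _) (hm'.trans (hL _)) (add_left_cancel (hj'.symm.trans h2))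
      omega
    by_cases hMj : M (!i) (t + 1)
    · refine ⟨t + 2, by omega, Or.inl ⟨?_, ?_⟩⟩
      · rw [hmove i _ hMi', hi']
        ring
      · rw [hmove _ _ hMj, hj']
        ring
    · exact ⟨t + 1, by omega, Or.inr ⟨hMj, hi', hj'⟩⟩
  | succ j ih =>
    intro t m hm hMi hi hj
    have hi' : X i (t + 1) = N c - 1 := by rw [hstay i t hMi, hi]
    have hj' : X (!i) (t + 1) = N c - 1 + (m + 1 : ℕ) := by
      rw [hmove (!i) t ((hne i t).resolve_left hMi), hj]
      push_cast
      ring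
    obtain ⟨s, hs, h⟩ := ih (t + 1) (m + 1) (by omega)
      (hocc i (t + 1) c (m + 1) (by omega) (by omega) hi' hj') hi' hj'
    exact ⟨s, by omega, h⟩

/-- If the clusters are never blocked simultaneously, every delay is followed by a release: one
cluster has just passed a node that the other one has just left. -/
lemma exists_release {n : ℕ} (X : Bool → ℕ → ZMod n) (M : Bool → ℕ → Prop)
    (L : Bool → ℕ) (N : Bool → ZMod n) (hN : Function.Injective N) (hL : ∀ i, L i < n)
    (hL0 : ∀ i, 0 < L i)
    (hmove : ∀ i t, M i t → X i (t + 1) = X i t + 1)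
    (hstay : ∀ i t, ¬ M i t → X i (t + 1) = X i t)
    (hne : ∀ i t, M i t ∨ M (!i) t)
    (hblocked : ∀ i t, ¬ M i t → ∃ c, ∃ m < L (!i), X i t = N c - 1 ∧ X (!i) t = N c - 1 + m)
    (hocc : ∀ i t c m, 1 ≤ m → m < L (!i) → X i t = N c - 1 → X (!i) t = N c - 1 + (m : ℕ) →
      ¬ M i t)
    (i : Bool) (t : ℕ) (hMi : ¬ M i t) :
    ∃ s, t ≤ s ∧ ∃ i c, X i s = N c ∧ X (!i) s = N c + L (!i) := by
  have key := exists_release_or_blocked X M L N hN hL hmove hstay hne hblocked hocc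
  obtain ⟨b, m, hm, h1, h2⟩ := hblocked i t hMi
  obtain ⟨s, hs, h | ⟨hMj, h3, h4⟩⟩ := key i b (L (!i) - m - 1) t m (by omega) hMi h1 h2
  · exact ⟨s, hs, i, b, h⟩
  obtain ⟨b', m', hm', h5, h6⟩ := hblocked (!i) s hMj
  obtain ⟨u, hu, h | ⟨hMu, h7, h8⟩⟩ :=
    key (!i) b' (L (!!i) - m' - 1) s m' (by omega) hMj h5 h6
  · exact ⟨u, hs.trans hu, !i, b', h⟩
  rw [Bool.not_not] at *
  obtain ⟨c, k, hk, h9, -⟩ := hblocked i u hMu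
  have hbb' : b' ≠ b := by
    rintro rfl
    have := natCast_inj_of_lt (hL (!i)) (lt_of_le_of_lt (Nat.zero_le _) (hL i))
      (by simpa using h4.symm.trans h5)
    have := hL0 (!i)
    omega
  have hcb' : c ≠ b' := by
    rintro rfl
    have := natCast_inj_of_lt (hL i) (lt_of_le_of_lt (Nat.zero_le _) (hL i))
      (by simpa using h8.symm.trans h9)
    have := hL0 i
    omega
  obtain rfl : c = b := by
    cases c <;> cases b <;> cases b' <;> simp_all
  have := natCast_inj_of_lt (hL i) (hm'.trans (hL i))
    (add_left_cancel ((h8.symm.trans h9).trans (h3.symm.trans h6)))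
  omega

/-- Lemma 2: if the system is never eventually in free movement nor in collapse,
then it visits one of the four states `(l₁,0)`, `(0,l₂)`, `(d+l₁,d)`, `(d,d+l₂)`
at arbitrarily large times. -/
theorem lemma2_visits_release_states (n d l₁ l₂ : ℕ)
    (hd : 0 < d) (hdn : 2 * d ≤ n) (hl₁ : 0 < l₁) (hl₁₂ : l₁ ≤ l₂) (hl₂ : l₂ < n)
    (x0 : TCState n) (hadm : Admissible n d l₁ l₂ x0)
    (hfree : ∀ t₀ : ℕ, ¬ FreeFrom n d l₁ l₂ x0 t₀)
    (hcol : ∀ t₀ : ℕ, ¬ CollapseFrom n d l₁ l₂ x0 t₀) :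
    ∀ T : ℕ, ∃ t, T ≤ t ∧
      (traj n d l₁ l₂ x0 t = ((l₁ : ZMod n), 0) ∨
       traj n d l₁ l₂ x0 t = (0, (l₂ : ZMod n)) ∨
       traj n d l₁ l₂ x0 t = (((d + l₁ : ℕ) : ZMod n), (d : ZMod n)) ∨
       traj n d l₁ l₂ x0 t = ((d : ZMod n), ((d + l₂ : ℕ) : ZMod n))) := by
  intro T
  have hn : d < n := by omega
  set Y := traj n d l₁ l₂ x0
  let X : Bool → ℕ → ZMod n := fun i t => bif i then (Y t).2 else (Y t).1
  let M : Bool → ℕ → Prop := fun i t => bif i then Moves2 n d l₁ (Y t) else Moves1 n d l₂ (Y t)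
  let L : Bool → ℕ := fun i => bif i then l₂ else l₁
  let N : Bool → ZMod n := fun c => bif c then (d : ZMod n) else 0
  have hd0 : (d : ZMod n) ≠ 0 := fun h =>
    hd.ne' (natCast_inj_of_lt hn (hd.trans hn) (by simpa using h))
  have hN : Function.Injective N := by
    intro a b h
    cases a <;> cases b <;> simp_all [N]
  have hstep : ∀ t, Y (t + 1) = tcStep n d l₁ l₂ (Y t) := traj_succ n d l₁ l₂ x0
  have hmove : ∀ i t, M i t → X i (t + 1) = X i t + 1 := by
    intro i t h
    cases i <;> simp_all [M, X, tcStep]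
  have hstay : ∀ i t, ¬ M i t → X i (t + 1) = X i t := by
    intro i t h
    cases i <;> simp_all [M, X, tcStep]
  have hne : ∀ i t, M i t ∨ M (!i) t := by
    intro i t
    cases i
    · exact moves1_or_moves2 hcol t
    · exact (moves1_or_moves2 hcol t).symm
  have hblocked : ∀ i t, ¬ M i t →
      ∃ c, ∃ m < L (!i), X i t = N c - 1 ∧ X (!i) t = N c - 1 + m := by
    intro i t h
    cases i
    · rcases not_not.1 h with ⟨h1, k, hk, h2⟩ | ⟨h1, k, hk, h2⟩
      · exact ⟨false, k + 1, hk, by simpa [X, N, AtNode1] using h1,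
          by simpa [X, N] using h2⟩
      · refine ⟨true, k + 1, hk, h1, h2.trans ?_⟩
        simp only [N, cond_true]
        push_cast
        ring
    · rcases not_not.1 h with ⟨h1, k, hk, h2⟩ | ⟨h1, k, hk, h2⟩ | ⟨h1, h2⟩ | ⟨h1, h2⟩
      · exact ⟨false, k + 1, hk, by simpa [X, N, AtNode1] using h1,
          by simpa [X, N] using h2⟩
      · refine ⟨true, k + 1, hk, h1, h2.trans ?_⟩
        simp only [N, cond_true]
        push_cast
        ring
      · exact ⟨false, 0, hl₁, by simpa [X, N, AtNode1] using h2,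
          by simpa [X, N, AtNode1] using h1⟩
      · exact ⟨true, 0, hl₁, h2, by simpa [X, N, AtNode2] using h1⟩
  have hocc : ∀ i t c m, 1 ≤ m → m < L (!i) → X i t = N c - 1 →
      X (!i) t = N c - 1 + (m : ℕ) → ¬ M i t := by
    intro i t c m hm hmL h1 h2
    obtain ⟨k, rfl⟩ := Nat.exists_eq_add_of_le' hm
    have h3 : X (!i) t = N c + k := by
      rw [h2]
      push_cast
      ring
    cases i <;> cases c
    · exact not_not.2 (Or.inl ⟨by simpa [X, N, AtNode1] using h1, k, hmL,
        by simpa [X, N] using h3⟩)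
    · exact not_not.2 (Or.inr ⟨h1, k, hmL, by simpa [X, N] using h3⟩)
    · exact not_not.2 (Or.inl ⟨by simpa [X, N, AtNode1] using h1, k, hmL,
        by simpa [X, N] using h3⟩)
    · exact not_not.2 (Or.inr (Or.inl ⟨h1, k, hmL, by simpa [X, N] using h3⟩))
  obtain ⟨t, hTt, i, hMi⟩ : ∃ t, T ≤ t ∧ ∃ i, ¬ M i t := by
    by_contra! h
    exact hfree T fun t ht => ⟨h t ht false, h t ht true⟩
  have hL : ∀ i, L i < n := by
    intro i
    cases i
    · exact hl₁₂.trans_lt hl₂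
    · exact hl₂
  have hL0 : ∀ i, 0 < L i := by
    intro i
    cases i
    · exact hl₁
    · exact hl₁.trans_le hl₁₂
  obtain ⟨s, hs, j, c, h1, h2⟩ :=
    exists_release X M L N hN hL hL0 hmove hstay hne hblocked hocc i t hMi
  refine ⟨s, hTt.trans hs, ?_⟩
  cases j <;> cases c <;> simp only [X, N, L, Bool.not_false, Bool.not_true, cond_true, cond_false,
    zero_add] at h1 h2
  · exact Or.inr (Or.inl (Prod.ext h1 h2))
  · exact Or.inr (Or.inr (Or.inr (Prod.ext h1 (by simpa using h2))))
  · exact Or.inl (Prod.ext h2 h1)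
  · exact Or.inr (Or.inr (Or.inl (Prod.ext (by simpa using h2) h1)))
end

section
/- Theorem 1: If l₁ + l₂ ≤ n, then from every admissible initial state there exists a time t₀ such that the system is in free movement from time t₀. -/
open Filter

/-- The lead of cluster 2 over cluster 1, as a residue in `{0, …, n-1}`. -/
def lead (n : ℕ) (x : TCState n) : ℕ := (x.2 - x.1).val

/-- The number of delays still needed to bring the lead into the range `[l₂, n - l₁]`
in which no conflict can occur. -/
def delaysLeft (n l₁ l₂ : ℕ) (x : TCState n) : ℕ :=
  if lead n x = 0 then l₁
  else if lead n x < l₂ then l₂ - lead n x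
  else lead n x - (n - l₁)

lemma lead_of_not_moves1 {n d l₂ : ℕ} (hl₂ : l₂ < n) {x : TCState n}
    (hx : ¬ Moves1 n d l₂ x) : 0 < lead n x ∧ lead n x < l₂ := by
  have key : ∃ k : ℕ, k + 2 ≤ l₂ ∧ x.2 - x.1 = ((k + 1 : ℕ) : ZMod n) := by
    rcases not_not.mp hx with ⟨h₁, k, hk, h₂⟩ | ⟨h₁, k, hk, h₂⟩
    all_goals
      refine ⟨k, hk, ?_⟩
      rw [h₁, h₂]
      push_cast
      ring
  obtain ⟨k, hk, hD⟩ := key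
  rw [lead, hD, ZMod.val_natCast_of_lt (by omega)]
  omega

lemma lead_of_not_moves2 {n d l₁ : ℕ} (hl₁ : l₁ ≤ n) {x : TCState n}
    (hx : ¬ Moves2 n d l₁ x) : lead n x = 0 ∨ n - l₁ < lead n x := by
  have key : x.2 - x.1 = 0 ∨
      ∃ k : ℕ, k + 2 ≤ l₁ ∧ x.2 - x.1 = ((n - (k + 1) : ℕ) : ZMod n) := by
    rcases not_not.mp hx with ⟨h₁, k, hk, h₂⟩ | ⟨h₁, k, hk, h₂⟩ | ⟨h₁, h₂⟩ | ⟨h₁, h₂⟩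
    · refine .inr ⟨k, hk, ?_⟩
      rw [h₁, h₂, Nat.cast_sub (by omega), ZMod.natCast_self]
      push_cast
      ring
    · refine .inr ⟨k, hk, ?_⟩
      rw [h₁, h₂, Nat.cast_sub (by omega), ZMod.natCast_self]
      push_cast
      ring
    · exact .inl (by rw [h₁, h₂, sub_self])
    · exact .inl (by rw [h₁, h₂, sub_self])
  rcases key with hD | ⟨k, hk, hD⟩
  · exact .inl (by rw [lead, hD, ZMod.val_zero])
  · rw [lead, hD, ZMod.val_natCast_of_lt (by omega)]
    omega

lemma delaysLeft_tcStep_of_moves {n d l₁ l₂ : ℕ} {x : TCState n}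
    (h₁ : Moves1 n d l₂ x) (h₂ : Moves2 n d l₁ x) :
    delaysLeft n l₁ l₂ (tcStep n d l₁ l₂ x) = delaysLeft n l₁ l₂ x := by
  have hlead : lead n (tcStep n d l₁ l₂ x) = lead n x := by
    simp [lead, tcStep, h₁, h₂]
  simp only [delaysLeft, hlead]

lemma delaysLeft_tcStep_lt {n d l₁ l₂ : ℕ} (hl₁ : 0 < l₁) (hl₁₂ : l₁ ≤ l₂) (hl₂ : l₂ < n)
    (h : l₁ + l₂ ≤ n) {x : TCState n} (hx : ¬ (Moves1 n d l₂ x ∧ Moves2 n d l₁ x)) :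
    delaysLeft n l₁ l₂ (tcStep n d l₁ l₂ x) < delaysLeft n l₁ l₂ x := by
  have : NeZero n := ⟨by omega⟩
  have hlt : lead n x < n := ZMod.val_lt _
  have hcast : ((lead n x : ℕ) : ZMod n) = x.2 - x.1 := ZMod.natCast_zmod_val _
  by_cases h₁ : Moves1 n d l₂ x
  · have h₂ : ¬ Moves2 n d l₁ x := fun h₂ => hx ⟨h₁, h₂⟩
    have hrange := lead_of_not_moves2 (by omega) h₂
    have hlead : lead n (tcStep n d l₁ l₂ x) = if lead n x = 0 then n - 1 else lead n x - 1 := by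
      have hstep : lead n (tcStep n d l₁ l₂ x) = (x.2 - x.1 - 1).val := by
        simp [lead, tcStep, h₁, h₂, sub_sub]
      rw [hstep, ← hcast]
      split_ifs with h0
      · rw [h0, ← ZMod.val_natCast_of_lt (show n - 1 < n by omega),
          Nat.cast_sub (by omega), ZMod.natCast_self]
        simp
      · rw [← ZMod.val_natCast_of_lt (show lead n x - 1 < n by omega),
          Nat.cast_sub (by omega), Nat.cast_one]
    unfold delaysLeft
    split_ifs at hlead ⊢ <;> omega
  · have hrange := lead_of_not_moves1 hl₂ h₁
    have h₂ : Moves2 n d l₁ x := by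
      by_contra h₂
      have := lead_of_not_moves2 (by omega) h₂
      omega
    have hlead : lead n (tcStep n d l₁ l₂ x) = lead n x + 1 := by
      have hstep : lead n (tcStep n d l₁ l₂ x) = (x.2 - x.1 + 1).val := by
        simp [lead, tcStep, h₁, h₂, add_sub_right_comm]
      rw [hstep, ← hcast, ← Nat.cast_succ, ZMod.val_natCast_of_lt (by omega)]
    unfold delaysLeft
    split_ifs <;> omega

/-- Theorem 1: if `l₁ + l₂ ≤ n`, the system results in a state of free movement
from any admissible initial state. -/
theorem theorem1_free_movement (n d l₁ l₂ : ℕ)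
    (hd : 0 < d) (hdn : 2 * d ≤ n) (hl₁ : 0 < l₁) (hl₁₂ : l₁ ≤ l₂) (hl₂ : l₂ < n)
    (h : l₁ + l₂ ≤ n) :
    ∀ x0 : TCState n, Admissible n d l₁ l₂ x0 →
      ∃ t₀ : ℕ, FreeFrom n d l₁ l₂ x0 t₀ := by
  intro x0 _
  have hsucc (t : ℕ) : traj n d l₁ l₂ x0 (t + 1) = tcStep n d l₁ l₂ (traj n d l₁ l₂ x0 t) :=
    Function.iterate_succ_apply' _ _ _
  have hanti : Antitone fun t => delaysLeft n l₁ l₂ (traj n d l₁ l₂ x0 t) := by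
    refine antitone_nat_of_succ_le fun t => ?_
    rw [hsucc]
    by_cases hm : Moves1 n d l₂ (traj n d l₁ l₂ x0 t) ∧ Moves2 n d l₁ (traj n d l₁ l₂ x0 t)
    · exact (delaysLeft_tcStep_of_moves hm.1 hm.2).le
    · exact (delaysLeft_tcStep_lt hl₁ hl₁₂ hl₂ h hm).le
  obtain ⟨t₀, ht₀⟩ : ∃ t₀, ∀ t, delaysLeft n l₁ l₂ (traj n d l₁ l₂ x0 t₀) ≤
      delaysLeft n l₁ l₂ (traj n d l₁ l₂ x0 t) :=
    ⟨Function.argmin fun t => delaysLeft n l₁ l₂ (traj n d l₁ l₂ x0 t),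
      fun t => Function.argmin_le (fun t => delaysLeft n l₁ l₂ (traj n d l₁ l₂ x0 t)) t⟩
  refine ⟨t₀, fun t ht => ?_⟩
  by_contra hm
  have hlt := delaysLeft_tcStep_lt hl₁ hl₁₂ hl₂ h hm
  rw [← hsucc] at hlt
  exact absurd (hlt.trans_le (hanti ht)) (ht₀ (t + 1)).not_gt
end

section
/- If l₁ + l₂ ≤ n, then from every admissible initial state the average velocities of both clusters exist and v₁ = v₂ = 1. -/
open Filter

/-- The number of delays still possible when cluster 2 is ahead of cluster 1 by `δ` cells:
the distance from `δ` to the interval `[l₂, n - l₁]` of delay-free shifts, where `δ ∈ [1, l₂)`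
can only grow and the other shifts can only decrease. -/
def delayPotential (n l₁ l₂ : ℕ) (δ : ZMod n) : ℕ :=
  if δ.val = 0 then l₁ else if δ.val < l₂ then l₂ - δ.val else δ.val - (n - l₁)

lemma delayPotential_natCast {n l₁ l₂ j : ℕ} (h : l₁ + l₂ ≤ n) (hl₂ : l₂ < n)
    (hj : 0 < j) (hjl : j ≤ l₂) : delayPotential n l₁ l₂ (j : ZMod n) = l₂ - j := by
  have hv : (j : ZMod n).val = j := ZMod.val_cast_of_lt (by omega)
  unfold delayPotential
  rw [hv]
  split_ifs <;> omega

lemma delayPotential_neg_natCast {n l₁ l₂ j : ℕ} (h : l₁ + l₂ ≤ n) (hl₁ : l₁ < n)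
    (hjl : j ≤ l₁) : delayPotential n l₁ l₂ (-(j : ZMod n)) = l₁ - j := by
  rcases Nat.eq_zero_or_pos j with rfl | hj
  · simp [delayPotential]
  · have hv : (-(j : ZMod n)).val = n - j := by
      rw [← ZMod.val_cast_of_lt (show n - j < n by omega), Nat.cast_sub (by omega)]
      simp
    unfold delayPotential
    rw [hv]
    split_ifs <;> omega

lemma exists_shift_of_not_moves1 {n d l₂ : ℕ} {x : TCState n} (hx : ¬ Moves1 n d l₂ x) :
    ∃ j : ℕ, 0 < j ∧ j < l₂ ∧ x.2 - x.1 = j := by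
  rcases not_not.mp hx with ⟨h₁, k, hk, h₂⟩ | ⟨h₁, k, hk, h₂⟩
  · refine ⟨k + 1, by omega, by omega, ?_⟩
    rw [h₂, show x.1 = -1 from h₁]
    push_cast
    ring
  · refine ⟨k + 1, by omega, by omega, ?_⟩
    rw [h₂, show x.1 = d - 1 from h₁]
    push_cast
    ring

lemma exists_shift_of_not_moves2 {n d l₁ : ℕ} (hl₁ : 0 < l₁) {x : TCState n}
    (hx : ¬ Moves2 n d l₁ x) : ∃ j : ℕ, j < l₁ ∧ x.2 - x.1 = -(j : ZMod n) := by
  rcases not_not.mp hx with ⟨h₂, k, hk, h₁⟩ | ⟨h₂, k, hk, h₁⟩ | ⟨h₁, h₂⟩ | ⟨h₁, h₂⟩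
  · refine ⟨k + 1, by omega, ?_⟩
    rw [h₁, show x.2 = -1 from h₂]
    push_cast
    ring
  · refine ⟨k + 1, by omega, ?_⟩
    rw [h₁, show x.2 = d - 1 from h₂]
    push_cast
    ring
  · exact ⟨0, hl₁, by rw [show x.1 = -1 from h₁, show x.2 = -1 from h₂]; simp⟩
  · exact ⟨0, hl₁, by rw [show x.1 = d - 1 from h₁, show x.2 = d - 1 from h₂]; simp⟩

lemma moves1_or_moves2_s4 {n d l₁ l₂ : ℕ} (hl₁ : 0 < l₁) (h : l₁ + l₂ ≤ n) (x : TCState n) :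
    Moves1 n d l₂ x ∨ Moves2 n d l₁ x := by
  by_contra! hx
  obtain ⟨j, hj, hjl, hδ⟩ := exists_shift_of_not_moves1 hx.1
  obtain ⟨k, hkl, hδ'⟩ := exists_shift_of_not_moves2 hl₁ hx.2
  have hz : ((j + k : ℕ) : ZMod n) = 0 := by
    push_cast
    rw [← hδ, hδ']
    ring
  have := Nat.le_of_dvd (by omega) ((ZMod.natCast_eq_zero_iff _ _).mp hz)
  omega

open Classical in
/-- Each delay of either cluster lowers the potential by one. -/
lemma delayPotential_tcStep {n d l₁ l₂ : ℕ} (hl₁ : 0 < l₁) (hl₁₂ : l₁ ≤ l₂) (hl₂ : l₂ < n)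
    (h : l₁ + l₂ ≤ n) (x : TCState n) :
    delayPotential n l₁ l₂ ((tcStep n d l₁ l₂ x).2 - (tcStep n d l₁ l₂ x).1) +
      ((if Moves1 n d l₂ x then 0 else 1) + (if Moves2 n d l₁ x then 0 else 1)) =
    delayPotential n l₁ l₂ (x.2 - x.1) := by
  by_cases h₁ : Moves1 n d l₂ x <;> by_cases h₂ : Moves2 n d l₁ x
  · simp [tcStep, h₁, h₂]
  · obtain ⟨j, hjl, hδ⟩ := exists_shift_of_not_moves2 hl₁ h₂
    have hδ' : x.2 - (x.1 + 1) = -((j + 1 : ℕ) : ZMod n) := by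
      push_cast
      linear_combination hδ
    simp only [tcStep, h₁, h₂, if_true, if_false]
    rw [hδ, hδ', delayPotential_neg_natCast h (by omega) (by omega),
      delayPotential_neg_natCast h (by omega) (by omega)]
    omega
  · obtain ⟨j, hj, hjl, hδ⟩ := exists_shift_of_not_moves1 h₁
    have hδ' : x.2 + 1 - x.1 = ((j + 1 : ℕ) : ZMod n) := by
      push_cast
      linear_combination hδ
    simp only [tcStep, h₁, h₂, if_true, if_false]
    rw [hδ, hδ', delayPotential_natCast h hl₂ (by omega) (by omega),
      delayPotential_natCast h hl₂ (by omega) (by omega)]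
    omega
  · exact absurd (moves1_or_moves2_s4 (d := d) hl₁ h x) (by simp [h₁, h₂])

open Classical in
/-- If a natural-valued potential decreases whenever `P` fails along an orbit, then `P` holds at
all but boundedly many times. -/
lemma le_card_filter_iterate_add {α : Type*} (f : α → α) (P : α → Prop) (Φ : α → ℕ)
    (hΦ : ∀ x, Φ (f x) + (if P x then 0 else 1) ≤ Φ x) (x : α) (t : ℕ) :
    t + Φ (f^[t] x) ≤ ((Finset.range t).filter (fun s => P (f^[s] x))).card + Φ x := by
  induction t with
  | zero => simp
  | succ t ih =>
    have hstep := hΦ (f^[t] x)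
    rw [Finset.range_add_one, Finset.filter_insert, Function.iterate_succ_apply']
    split_ifs at hstep ⊢ with hP
    · rw [Finset.card_insert_of_notMem (by simp)]
      omega
    · omega

lemma tendsto_div_atTop_one_of_le_add {H : ℕ → ℕ} (C : ℕ) (hH : ∀ t, H t ≤ t)
    (hC : ∀ t, t ≤ H t + C) : Tendsto (fun t : ℕ => (H t : ℝ) / t) atTop (nhds 1) := by
  have hlim : Tendsto (fun t : ℕ => 1 - (C : ℝ) / t) atTop (nhds 1) := by
    simpa using (tendsto_const_div_atTop_nhds_zero_nat (C : ℝ)).const_sub 1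
  refine tendsto_of_tendsto_of_tendsto_of_le_of_le' hlim tendsto_const_nhds ?_ ?_
  · filter_upwards [eventually_gt_atTop 0] with t ht
    have ht' : (0 : ℝ) < t := by exact_mod_cast ht
    have hCt : (t : ℝ) ≤ H t + C := by exact_mod_cast hC t
    rw [one_sub_div ht'.ne']
    gcongr
    linarith
  · exact Eventually.of_forall fun t =>
      div_le_one_of_le₀ (by exact_mod_cast hH t) (Nat.cast_nonneg t)

/-- If `l₁ + l₂ ≤ n`, then from any admissible initial state the average
velocities of both clusters exist and `v₁ = v₂ = 1`. -/
theorem velocity_one_of_le (n d l₁ l₂ : ℕ)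
    (hd : 0 < d) (hdn : 2 * d ≤ n) (hl₁ : 0 < l₁) (hl₁₂ : l₁ ≤ l₂) (hl₂ : l₂ < n)
    (h : l₁ + l₂ ≤ n) :
    ∀ x0 : TCState n, Admissible n d l₁ l₂ x0 →
      Tendsto (fun t : ℕ => (H1 n d l₁ l₂ x0 t : ℝ) / t) atTop (nhds 1) ∧
      Tendsto (fun t : ℕ => (H2 n d l₁ l₂ x0 t : ℝ) / t) atTop (nhds 1) := by
  classical
  intro x0 _
  have hcard (P : ℕ → Prop) (t : ℕ) : ((Finset.range t).filter P).card ≤ t := by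
    simpa using Finset.card_filter_le (Finset.range t) P
  have hstep := delayPotential_tcStep (d := d) hl₁ hl₁₂ hl₂ h
  have hcount (P : TCState n → Prop) := le_card_filter_iterate_add (tcStep n d l₁ l₂) P
    (fun x => delayPotential n l₁ l₂ (x.2 - x.1))
  constructor
  · refine tendsto_div_atTop_one_of_le_add (delayPotential n l₁ l₂ (x0.2 - x0.1))
      (fun t => hcard _ t) fun t => ?_
    exact (Nat.le_add_right _ _).trans
      (hcount (Moves1 n d l₂) (fun x => by have := hstep x; omega) x0 t)
  · refine tendsto_div_atTop_one_of_le_add (delayPotential n l₁ l₂ (x0.2 - x0.1))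
      (fun t => hcard _ t) fun t => ?_
    exact (Nat.le_add_right _ _).trans
      (hcount (Moves2 n d l₁) (fun x => by have := hstep x; omega) x0 t)
end

section
/- For all admissible parameters n, d, l₁, l₂ and every admissible initial state, the average velocities of both clusters exist and are equal: v₁ = v₂; moreover this common value does not depend on the initial state. -/
open Filter

/-- Cluster 1 is blocked when the leading cells are numbered `a`, `b`. -/
def Blocked1 (n d l₂ a b : ℕ) : Prop :=
  (a + 1 = n ∧ b + 2 ≤ l₂) ∨ (a + 1 = d ∧ (d ≤ b ∧ b + 2 ≤ d + l₂ ∨ b + n + 2 ≤ d + l₂))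

/-- Cluster 2 is blocked when the leading cells are numbered `a`, `b`. -/
def Blocked2 (n d l₁ a b : ℕ) : Prop :=
  (b + 1 = n ∧ a + 2 ≤ l₁) ∨ (b + 1 = d ∧ (d ≤ a ∧ a + 2 ≤ d + l₁ ∨ a + n + 2 ≤ d + l₁)) ∨
    (a + 1 = n ∧ b + 1 = n) ∨ (a + 1 = d ∧ b + 1 = d)

/-- One step of a single cluster: cell number `a`, number of advances `h`, blocked if `p`. -/
def CellStep (n : ℕ) (p : Prop) (a h a' h' : ℕ) : Prop :=
  (p ∧ a' = a ∧ h' = h) ∨ (¬ p ∧ a + 1 < n ∧ a' = a + 1 ∧ h' = h + 1) ∨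
    (¬ p ∧ a + 1 = n ∧ a' = 0 ∧ h' = h + 1)

/-- The cell numbers `a`, `b` of the clusters and their numbers of advances `h₁`, `h₂`
evolve according to the dynamics. -/
structure IsOrbit (n d l₁ l₂ : ℕ) (a b h₁ h₂ : ℕ → ℕ) : Prop where
  lt₁ : ∀ t, a t < n
  lt₂ : ∀ t, b t < n
  zero₁ : h₁ 0 = 0
  zero₂ : h₂ 0 = 0
  step₁ : ∀ t, CellStep n (Blocked1 n d l₂ (a t) (b t)) (a t) (h₁ t) (a (t + 1)) (h₁ (t + 1))
  step₂ : ∀ t, CellStep n (Blocked2 n d l₁ (a t) (b t)) (b t) (h₂ t) (b (t + 1)) (h₂ (t + 1))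

/-- The counting function `h` grows with slope `p / q` up to a bounded error. -/
def HasSlope (p q : ℤ) (h : ℕ → ℕ) : Prop :=
  ∃ (k : ℕ) (C : ℤ), ∀ t, k ≤ t → |q * h t - p * t| ≤ C

theorem HasSlope.tendsto {p q : ℤ} {h : ℕ → ℕ} (hq : 0 < q) (H : HasSlope p q h) :
    Tendsto (fun t : ℕ => (h t : ℝ) / t) atTop (nhds ((p : ℝ) / q)) := by
  obtain ⟨k, C, hC⟩ := H
  have hq' : (0 : ℝ) < q := by exact_mod_cast hq
  rw [tendsto_iff_dist_tendsto_zero]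
  have hlim : Tendsto (fun t : ℕ => ((C : ℝ) / q) / t) atTop (nhds 0) :=
    tendsto_const_div_atTop_nhds_zero_nat _
  refine squeeze_zero' (Eventually.of_forall fun _ => dist_nonneg) ?_ hlim
  filter_upwards [eventually_ge_atTop k, eventually_gt_atTop 0] with t hk ht
  have ht' : (0 : ℝ) < t := by exact_mod_cast ht
  have h1 : |(q : ℝ) * h t - p * t| ≤ C := by exact_mod_cast hC t hk
  have h2 : (h t : ℝ) / t - p / q = (q * h t - p * t) / (q * t) := by field_simp
  rw [Real.dist_eq, h2, abs_div, abs_of_pos (mul_pos hq' ht'), div_div]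
  gcongr

theorem HasSlope.of_dist_le {p q : ℤ} {h h' : ℕ → ℕ} (H : HasSlope p q h) (hq : 0 ≤ q)
    {k : ℕ} {C : ℤ} (hC : ∀ t, k ≤ t → |(h' t : ℤ) - h t| ≤ C) : HasSlope p q h' := by
  obtain ⟨k', C', hC'⟩ := H
  refine ⟨max k k', C' + q * C, fun t ht => ?_⟩
  have h1 := hC t (le_trans (le_max_left _ _) ht)
  have h2 := hC' t (le_trans (le_max_right _ _) ht)
  have h3 : q * h' t - p * t = (q * h t - p * t) + q * (h' t - h t) := by ring
  rw [h3]
  refine (abs_add_le _ _).trans (add_le_add h2 ?_)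
  rw [abs_mul, abs_of_nonneg hq]
  exact mul_le_mul_of_nonneg_left h1 hq

/-- The cell number changes from `a` to `a'`, the number of advances from `h` to `h'`, and the phase
from `θ` to `θ'`, where the phase advances by one at each step and returns to `0` after `P` steps,
exactly when the cluster completes a revolution. -/
def PhaseStep (n P a h θ a' h' θ' : ℕ) : Prop :=
  (a' = a ∧ h' = h ∧ θ' = θ + 1) ∨ (a' = a + 1 ∧ h' = h + 1 ∧ θ' = θ + 1) ∨
    (a + 1 = n ∧ a' = 0 ∧ h' = h + 1 ∧ θ + 1 = P ∧ θ' = 0)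

/-- A cluster that performs a revolution in `P` steps has slope `n / P`. -/
theorem hasSlope_of_phase {n P k θ₀ : ℕ} {a h : ℕ → ℕ} {R : ℕ → ℕ → Prop} (ha : ∀ t, a t < n)
    (h₀ : R k θ₀) (hR : ∀ t θ, R t θ → θ < P)
    (hstep : ∀ t θ, R t θ →
      ∃ θ', R (t + 1) θ' ∧ PhaseStep n P (a t) (h t) θ (a (t + 1)) (h (t + 1)) θ') :
    HasSlope n P h := by
  have key : ∀ t, k ≤ t → ∃ θ, R t θ ∧ (P : ℤ) * (h t - a t) - n * (t - θ) =
      P * (h k - a k) - n * (k - θ₀) := by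
    intro t ht
    induction t, ht using Nat.le_induction with
    | base => exact ⟨θ₀, h₀, rfl⟩
    | succ t ht ih =>
      obtain ⟨θ, hθ, ih⟩ := ih
      obtain ⟨θ', hθ', hs⟩ := hstep t θ hθ
      refine ⟨θ', hθ', ?_⟩
      rw [← ih]
      rcases hs with ⟨h1, h2, h3⟩ | ⟨h1, h2, h3⟩ | ⟨h0, h1, h2, h3, h4⟩
      · rw [h1, h2, h3]; push_cast; ring
      · rw [h1, h2, h3]; push_cast; ring
      · rw [h1, h2, h4, ← h0, ← h3]; push_cast; ring
  set c : ℤ := P * (h k - a k) - n * (k - θ₀)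
  refine ⟨k, |c| + P * n + n * P, fun t ht => ?_⟩
  obtain ⟨θ, hθ, hc⟩ := key t ht
  have h1 : (P : ℤ) * h t - n * t = c + P * a t - n * θ := by
    rw [← hc]; ring
  have h2 : (P : ℤ) * a t ≤ P * n := by exact_mod_cast Nat.mul_le_mul_left _ (ha t).le
  have h3 : (n : ℤ) * θ ≤ n * P := by exact_mod_cast Nat.mul_le_mul_left _ (hR t θ hθ).le
  have h4 : (0 : ℤ) ≤ P * a t := by positivity
  have h5 : (0 : ℤ) ≤ n * θ := by positivity
  rw [h1, abs_le]
  constructor <;> linarith [neg_abs_le c, le_abs_self c]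

/-- The cyclic distance from `a` to `b`, as a number in `{1, …, n}`. -/
def cyclicGap (n a b : ℕ) : ℕ := if a < b then b - a else b + n - a

namespace IsOrbit

variable {n d l₁ l₂ : ℕ} {a b h₁ h₂ : ℕ → ℕ}

theorem le_time (o : IsOrbit n d l₁ l₂ a b h₁ h₂) (t : ℕ) : h₁ t ≤ t ∧ h₂ t ≤ t := by
  induction t with
  | zero => simp [o.zero₁, o.zero₂]
  | succ t ih =>
    have s1 := o.step₁ t
    have s2 := o.step₂ t
    simp only [CellStep] at s1 s2
    omega

theorem stay₁ (o : IsOrbit n d l₁ l₂ a b h₁ h₂) {t : ℕ} (h : Blocked1 n d l₂ (a t) (b t)) :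
    a (t + 1) = a t ∧ h₁ (t + 1) = h₁ t := by
  rcases o.step₁ t with s | s | s
  · exact s.2
  · exact absurd h s.1
  · exact absurd h s.1

theorem stay₂ (o : IsOrbit n d l₁ l₂ a b h₁ h₂) {t : ℕ} (h : Blocked2 n d l₁ (a t) (b t)) :
    b (t + 1) = b t ∧ h₂ (t + 1) = h₂ t := by
  rcases o.step₂ t with s | s | s
  · exact s.2
  · exact absurd h s.1
  · exact absurd h s.1

theorem move₁ (o : IsOrbit n d l₁ l₂ a b h₁ h₂) {t : ℕ} (h : ¬ Blocked1 n d l₂ (a t) (b t)) :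
    (a t + 1 < n ∧ a (t + 1) = a t + 1 ∨ a t + 1 = n ∧ a (t + 1) = 0) ∧
      h₁ (t + 1) = h₁ t + 1 := by
  rcases o.step₁ t with s | s | s
  · exact absurd s.1 h
  · exact ⟨Or.inl ⟨s.2.1, s.2.2.1⟩, s.2.2.2⟩
  · exact ⟨Or.inr ⟨s.2.1, s.2.2.1⟩, s.2.2.2⟩

theorem move₂ (o : IsOrbit n d l₁ l₂ a b h₁ h₂) {t : ℕ} (h : ¬ Blocked2 n d l₁ (a t) (b t)) :
    (b t + 1 < n ∧ b (t + 1) = b t + 1 ∨ b t + 1 = n ∧ b (t + 1) = 0) ∧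
      h₂ (t + 1) = h₂ t + 1 := by
  rcases o.step₂ t with s | s | s
  · exact absurd s.1 h
  · exact ⟨Or.inl ⟨s.2.1, s.2.2.1⟩, s.2.2.2⟩
  · exact ⟨Or.inr ⟨s.2.1, s.2.2.1⟩, s.2.2.2⟩

theorem cyclicGap_bounds (o : IsOrbit n d l₁ l₂ a b h₁ h₂) (t : ℕ) :
    1 ≤ cyclicGap n (a t) (b t) ∧ cyclicGap n (a t) (b t) ≤ n := by
  have := o.lt₁ t
  have := o.lt₂ t
  unfold cyclicGap
  split_ifs <;> omega

theorem cyclicGap_lt_of_blocked1 (o : IsOrbit n d l₁ l₂ a b h₁ h₂) {t : ℕ}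
    (h : Blocked1 n d l₂ (a t) (b t)) :
    cyclicGap n (a t) (b t) < l₂ := by
  have := o.lt₁ t
  have := o.lt₂ t
  simp only [Blocked1] at h
  unfold cyclicGap
  split_ifs <;> omega

theorem lt_cyclicGap_of_blocked2 (o : IsOrbit n d l₁ l₂ a b h₁ h₂) (hl₁ : 0 < l₁) {t : ℕ}
    (h : Blocked2 n d l₁ (a t) (b t)) :
    n < cyclicGap n (a t) (b t) + l₁ := by
  have := o.lt₁ t
  have := o.lt₂ t
  simp only [Blocked2] at h
  unfold cyclicGap
  split_ifs <;> omega

theorem cyclicGap_step (o : IsOrbit n d l₁ l₂ a b h₁ h₂) (hdn : 2 * d ≤ n) (hd : 0 < d)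
    (hl₁ : 0 < l₁) (hl₁' : l₁ < n) (hl₂ : l₂ < n) {t : ℕ}
    (hb : ¬ (Blocked1 n d l₂ (a t) (b t) ∧ Blocked2 n d l₁ (a t) (b t))) :
    cyclicGap n (a (t + 1)) (b (t + 1)) + h₁ (t + 1) + h₂ t =
      cyclicGap n (a t) (b t) + h₁ t + h₂ (t + 1) := by
  have s1 := o.step₁ t
  have s2 := o.step₂ t
  have ha := o.lt₁ t
  have hb' := o.lt₂ t
  have g1 := fun h => o.cyclicGap_lt_of_blocked1 (t := t) h
  have g2 := fun h => o.lt_cyclicGap_of_blocked2 hl₁ (t := t) h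
  have g3 := o.cyclicGap_bounds t
  unfold cyclicGap at *
  rcases s1 with ⟨p, s1⟩ | ⟨p, s1⟩ | ⟨p, s1⟩ <;> rcases s2 with ⟨q, s2⟩ | ⟨q, s2⟩ | ⟨q, s2⟩
  · exact absurd ⟨p, q⟩ hb
  all_goals
    simp only [p, q, true_implies, false_implies] at g1 g2
    split_ifs at * <;> omega

/-- If the clusters never are blocked simultaneously, they advance equally often
up to a bounded error. -/
theorem dist_le (o : IsOrbit n d l₁ l₂ a b h₁ h₂) (hdn : 2 * d ≤ n) (hd : 0 < d)
    (hl₁ : 0 < l₁) (hl₁' : l₁ < n) (hl₂ : l₂ < n) {k : ℕ}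
    (hk : ∀ t, k ≤ t → ¬ (Blocked1 n d l₂ (a t) (b t) ∧ Blocked2 n d l₁ (a t) (b t))) :
    ∀ t, k ≤ t → |(h₂ t : ℤ) - h₁ t| ≤ h₂ k + h₁ k + 2 * n := by
  have hconst : ∀ t, k ≤ t → (h₂ t : ℤ) - h₁ t - cyclicGap n (a t) (b t) =
      h₂ k - h₁ k - cyclicGap n (a k) (b k) := by
    intro t ht
    induction t, ht using Nat.le_induction with
    | base => rfl
    | succ t ht ih =>
      have := o.cyclicGap_step hdn hd hl₁ hl₁' hl₂ (hk t ht)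
      omega
  intro t ht
  have h1 := hconst t ht
  have h2 := o.cyclicGap_bounds t
  have h3 := o.cyclicGap_bounds k
  rw [abs_le]
  omega

/-- The number of steps for which a cluster still has to wait when the cyclic distance between the
clusters is `g` and `l₁ + l₂ ≤ n`. -/
def remainingWait (n l₁ l₂ g : ℕ) : ℕ := (l₂ - g) + (l₁ + g - n)

theorem hasSlope_of_add_le (o : IsOrbit n d l₁ l₂ a b h₁ h₂) (hdn : 2 * d ≤ n) (hd : 0 < d)
    (hl₁ : 0 < l₁) (hl₁₂ : l₁ ≤ l₂) (hl₂ : l₂ < n) (h : l₁ + l₂ ≤ n) :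
    HasSlope 1 1 h₁ ∧ HasSlope 1 1 h₂ := by
  have key : ∀ t, 2 * t + remainingWait n l₁ l₂ (cyclicGap n (a t) (b t)) ≤
      h₁ t + h₂ t + remainingWait n l₁ l₂ (cyclicGap n (a 0) (b 0)) := by
    intro t
    induction t with
    | zero => omega
    | succ t ih =>
      have g1 := fun h => o.cyclicGap_lt_of_blocked1 (t := t) h
      have g2 := fun h => o.lt_cyclicGap_of_blocked2 hl₁ (t := t) h
      have g3 := o.cyclicGap_step hdn hd hl₁ (hl₁₂.trans_lt hl₂) hl₂ (t := t) fun hb => by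
        have := g1 hb.1
        have := g2 hb.2
        omega
      simp only [remainingWait] at *
      rcases o.step₁ t with ⟨p, s1⟩ | ⟨p, s1⟩ | ⟨p, s1⟩ <;>
        rcases o.step₂ t with ⟨q, s2⟩ | ⟨q, s2⟩ | ⟨q, s2⟩ <;>
        simp only [p, q, true_implies, false_implies] at g1 g2 <;> omega
  have bound : ∀ t, 2 * t ≤
      h₁ t + h₂ t + remainingWait n l₁ l₂ (cyclicGap n (a 0) (b 0)) := fun t =>
    (Nat.le_add_right _ _).trans (key t)
  refine ⟨⟨0, remainingWait n l₁ l₂ (cyclicGap n (a 0) (b 0)), fun t _ => ?_⟩,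
    ⟨0, remainingWait n l₁ l₂ (cyclicGap n (a 0) (b 0)), fun t _ => ?_⟩⟩
  all_goals
    have h1 := bound t
    have h2 := o.le_time t
    rw [abs_le]
    omega

/-- If `n < l₁ + l₂`, the clusters cannot move freely forever. -/
theorem exists_blocked (o : IsOrbit n d l₁ l₂ a b h₁ h₂) (hl₁ : l₁ < n) (hl₂ : l₂ < n)
    (h : n < l₁ + l₂) :
    ∃ t, Blocked1 n d l₂ (a t) (b t) ∨ Blocked2 n d l₁ (a t) (b t) := by
  by_contra! hfree
  have s1 := fun t => (o.move₁ (hfree t).1).1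
  have s2 := fun t => (o.move₂ (hfree t).2).1
  have late : ∀ k t, b t + k + 1 = n → ¬ a t + k + 2 ≤ l₁ := by
    intro k
    induction k with
    | zero =>
      intro t hb ha
      exact (hfree t).2 (Or.inl ⟨by omega, by omega⟩)
    | succ k ih =>
      intro t hb ha
      have := s1 t
      have := s2 t
      exact ih (t + 1) (by omega) (by omega)
  have early : ∀ k t, a t + k + 1 ≠ n := by
    intro k
    induction k with
    | zero =>
      intro t ha
      have := s1 t
      have := s2 t
      have hb := (hfree t).1
      have hb' := (hfree t).2
      simp only [Blocked1, Blocked2] at hb hb'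
      exact late (n - b (t + 1) - 1) (t + 1) (by omega) (by omega)
    | succ k ih =>
      intro t ha
      have := s1 t
      exact ih (t + 1) (by omega)
  have := o.lt₁ 0
  exact early (n - a 0 - 1) 0 (by omega)

/-- One of the clusters has just been released from a node. -/
def Corner (n d l₁ l₂ a b : ℕ) : Prop :=
  (a + 1 = n ∧ b + 1 = l₂) ∨ (a + 1 = d ∧ (b + 1 = d + l₂ ∨ b + 1 + n = d + l₂)) ∨
    (b + 1 = n ∧ a + 1 = l₁) ∨ (b + 1 = d ∧ a + 1 = d + l₁)

theorem exists_corner (o : IsOrbit n d l₁ l₂ a b h₁ h₂) (hdn : 2 * d ≤ n) (hd : 0 < d)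
    (hl₁ : 0 < l₁) (hl₁₂ : l₁ ≤ l₂) (hl₂ : l₂ < n) (h : n < l₁ + l₂) (h' : l₁ + d ≤ n)
    (hc : l₁ ≤ d ∨ l₂ + d ≤ n) : ∃ t, Corner n d l₁ l₂ (a t) (b t) := by
  have c1 : ∀ k t, a t + 1 = n → b t + k + 1 = l₂ → ∃ t, Corner n d l₁ l₂ (a t) (b t) := by
    intro k
    induction k with
    | zero => exact fun t ha hb => ⟨t, Or.inl ⟨ha, hb⟩⟩
    | succ k ih =>
      intro t ha hb
      have s1 := o.step₁ t
      have s2 := o.step₂ t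
      simp only [CellStep, Blocked1, Blocked2] at s1 s2
      exact ih (t + 1) (by omega) (by omega)
  have c2 : ∀ k t, a t + 1 = d → (d ≤ b t ∧ b t + k + 1 = d + l₂ ∨ b t + n + k + 1 = d + l₂) →
      ∃ t, Corner n d l₁ l₂ (a t) (b t) := by
    intro k
    induction k with
    | zero => exact fun t ha hb => ⟨t, Or.inr (Or.inl ⟨ha, by omega⟩)⟩
    | succ k ih =>
      intro t ha hb
      have s1 := o.step₁ t
      have s2 := o.step₂ t
      simp only [CellStep, Blocked1, Blocked2] at s1 s2
      exact ih (t + 1) (by omega) (by omega)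
  have c3 : ∀ k t, b t + 1 = n → (a t + k + 1 = l₁ ∨ a t + 1 = n ∧ k = l₁) →
      ∃ t, Corner n d l₁ l₂ (a t) (b t) := by
    intro k
    induction k with
    | zero => exact fun t hb ha => ⟨t, Or.inr (Or.inr (Or.inl ⟨hb, by omega⟩))⟩
    | succ k ih =>
      intro t hb ha
      have s1 := o.step₁ t
      have s2 := o.step₂ t
      simp only [CellStep, Blocked1, Blocked2] at s1 s2
      exact ih (t + 1) (by omega) (by omega)
  have c4 : ∀ k t, b t + 1 = d → (d ≤ a t + 1 ∧ a t + k + 1 = d + l₁) →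
      ∃ t, Corner n d l₁ l₂ (a t) (b t) := by
    intro k
    induction k with
    | zero => exact fun t hb ha => ⟨t, Or.inr (Or.inr (Or.inr ⟨hb, by omega⟩))⟩
    | succ k ih =>
      intro t hb ha
      have s1 := o.step₁ t
      have s2 := o.step₂ t
      simp only [CellStep, Blocked1, Blocked2] at s1 s2
      exact ih (t + 1) (by omega) (by omega)
  obtain ⟨t, ht⟩ := o.exists_blocked (by omega) hl₂ h
  rcases ht with (⟨ha, hb⟩ | ⟨ha, hb | hb⟩) | (⟨hb, ha⟩ | ⟨hb, ha | ha⟩ | ⟨ha, hb⟩ | ⟨ha, hb⟩)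
  · exact c1 (l₂ - b t - 1) t ha (by omega)
  · exact c2 (d + l₂ - b t - 1) t ha (by omega)
  · exact c2 (d + l₂ - b t - 1 - n) t ha (by omega)
  · exact c3 (l₁ - a t - 1) t hb (by omega)
  · exact c4 (d + l₁ - a t - 1) t hb (by omega)
  · omega
  · exact c3 l₁ t hb (by omega)
  · exact c4 l₁ t hb (by omega)

/-- The states of the limit cycle when `d < l₁` and `l₂ + d ≤ n`, together with the time `θ`
elapsed since cluster 1 has left node 1. -/
def LongCycle (n l₁ l₂ a b θ : ℕ) : Prop :=
  (a + l₂ = b ∧ θ = a) ∨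
  (b + 1 = n ∧ n ≤ a + 1 + l₂ ∧ a + 1 ≤ l₁ ∧ θ = a) ∨
  (b + l₁ = a ∧ θ = a) ∨
  (a + 1 = n ∧ n ≤ b + 1 + l₁ ∧ b + 1 ≤ l₂ ∧ θ = b + l₁)

theorem longCycle_step (o : IsOrbit n d l₁ l₂ a b h₁ h₂) (hdn : 2 * d ≤ n) (hd : 0 < d)
    (hl₁₂ : l₁ ≤ l₂) (hl₂ : l₂ < n) (h : n < l₁ + l₂) (hc₁ : d < l₁) (hc₂ : l₂ + d ≤ n)
    (t θ : ℕ) (H : LongCycle n l₁ l₂ (a t) (b t) θ) :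
    ∃ θ', LongCycle n l₁ l₂ (a (t + 1)) (b (t + 1)) θ' ∧
      PhaseStep n (l₁ + l₂) (a t) (h₁ t) θ (a (t + 1)) (h₁ (t + 1)) θ' := by
  have ha := o.lt₁ t
  have hb := o.lt₂ t
  have m1 := o.move₁ (t := t)
  have m2 := o.move₂ (t := t)
  have s1 := o.stay₁ (t := t)
  have s2 := o.stay₂ (t := t)
  simp only [Blocked1, Blocked2] at m1 m2 s1 s2
  have wait₂ : b t + 1 = n → n ≤ a t + 1 + l₂ → a t + 1 ≤ l₁ → θ = a t →
      ∃ θ', LongCycle n l₁ l₂ (a (t + 1)) (b (t + 1)) θ' ∧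
        PhaseStep n (l₁ + l₂) (a t) (h₁ t) θ (a (t + 1)) (h₁ (t + 1)) θ' := by
    intro h1 h2 h3 h4
    have e1 := m1 (by omega)
    by_cases h5 : a t + 1 = l₁
    · have e2 := m2 (by omega)
      exact ⟨θ + 1, Or.inr (Or.inr (Or.inl (by omega))), Or.inr (Or.inl (by omega))⟩
    · have e2 := s2 (by omega)
      exact ⟨θ + 1, Or.inr (Or.inl (by omega)), Or.inr (Or.inl (by omega))⟩
  have wait₁ : a t + 1 = n → n ≤ b t + 1 + l₁ → b t + 1 ≤ l₂ → θ = b t + l₁ →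
      ∃ θ', LongCycle n l₁ l₂ (a (t + 1)) (b (t + 1)) θ' ∧
        PhaseStep n (l₁ + l₂) (a t) (h₁ t) θ (a (t + 1)) (h₁ (t + 1)) θ' := by
    intro h1 h2 h3 h4
    have e2 := m2 (by omega)
    by_cases h5 : b t + 1 = l₂
    · have e1 := m1 (by omega)
      exact ⟨0, Or.inl (by omega), Or.inr (Or.inr (by omega))⟩
    · have e1 := s1 (by omega)
      exact ⟨θ + 1, Or.inr (Or.inr (Or.inr (by omega))), Or.inl (by omega)⟩
  rcases H with ⟨h1, h2⟩ | ⟨h1, h2, h3, h4⟩ | ⟨h1, h2⟩ | ⟨h1, h2, h3, h4⟩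
  · by_cases h5 : b t + 1 = n
    · exact wait₂ h5 (by omega) (by omega) h2
    · have e1 := m1 (by omega)
      have e2 := m2 (by omega)
      exact ⟨θ + 1, Or.inl (by omega), Or.inr (Or.inl (by omega))⟩
  · exact wait₂ h1 h2 h3 h4
  · by_cases h5 : a t + 1 = n
    · exact wait₁ h5 (by omega) (by omega) (by omega)
    · have e1 := m1 (by omega)
      have e2 := m2 (by omega)
      exact ⟨θ + 1, Or.inr (Or.inr (Or.inl (by omega))), Or.inr (Or.inl (by omega))⟩
  · exact wait₁ h1 h2 h3 h4

/-- The states of the limit cycle when `l₁ ≤ d`, together with the time `θ`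
elapsed since cluster 1 has left node 1. -/
def ShortCycle (n d l₁ l₂ a b θ : ℕ) : Prop :=
  (a + l₂ = b ∧ θ = a) ∨
  (b + 1 = n ∧ n ≤ a + 1 + l₂ ∧ a + 1 ≤ l₁ ∧ θ = a) ∨
  (b + l₁ = a ∧ a < d ∧ θ = a) ∨
  (a + 1 = d ∧ d ≤ b + l₁ + 1 ∧ b + n + 1 ≤ d + l₂ ∧ θ = b + l₁) ∨
  (a + l₂ = b + n ∧ d ≤ a ∧ b < d ∧ θ + n = a + l₁ + l₂) ∨
  (b + 1 = d ∧ d + n ≤ a + 1 + l₂ ∧ a + 1 ≤ d + l₁ ∧ θ + n = a + l₁ + l₂) ∨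
  (b + l₁ = a ∧ d + l₁ ≤ a + 1 ∧ θ + n = a + l₁ + l₂) ∨
  (a + 1 = n ∧ n ≤ b + 1 + l₁ ∧ b + 1 ≤ l₂ ∧ θ + n = b + 2 * l₁ + l₂)

theorem shortCycle_step (o : IsOrbit n d l₁ l₂ a b h₁ h₂) (hdn : 2 * d ≤ n)
    (hl₁ : 0 < l₁) (hl₂ : l₂ < n) (h : n < l₁ + l₂) (hc : l₁ ≤ d)
    (t θ : ℕ) (H : ShortCycle n d l₁ l₂ (a t) (b t) θ) :
    ∃ θ', ShortCycle n d l₁ l₂ (a (t + 1)) (b (t + 1)) θ' ∧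
      PhaseStep n (2 * l₁ + 2 * l₂ - n) (a t) (h₁ t) θ (a (t + 1)) (h₁ (t + 1)) θ' := by
  have ha := o.lt₁ t
  have hb := o.lt₂ t
  have m1 := o.move₁ (t := t)
  have m2 := o.move₂ (t := t)
  have s1 := o.stay₁ (t := t)
  have s2 := o.stay₂ (t := t)
  simp only [Blocked1, Blocked2] at m1 m2 s1 s2
  set C := ∃ θ', ShortCycle n d l₁ l₂ (a (t + 1)) (b (t + 1)) θ' ∧
      PhaseStep n (2 * l₁ + 2 * l₂ - n) (a t) (h₁ t) θ (a (t + 1)) (h₁ (t + 1)) θ'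
  have wait₁ : a t + 1 = n → n ≤ b t + 1 + l₁ → b t + 1 ≤ l₂ →
      θ + n = b t + 2 * l₁ + l₂ → C := by
    intro h1 h2 h3 h4
    have e2 := m2 (by omega)
    by_cases h5 : b t + 1 = l₂
    · have e1 := m1 (by omega)
      exact ⟨0, Or.inl (by omega), Or.inr (Or.inr (by omega))⟩
    · have e1 := s1 (by omega)
      exact ⟨θ + 1, Or.inr (Or.inr (Or.inr (Or.inr (Or.inr (Or.inr (Or.inr (by omega))))))),
        Or.inl (by omega)⟩
  have free₁ : b t + l₁ = a t → d + l₁ ≤ a t + 1 → θ + n = a t + l₁ + l₂ → C := by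
    intro h1 h2 h3
    by_cases h5 : a t + 1 = n
    · exact wait₁ h5 (by omega) (by omega) (by omega)
    · have e1 := m1 (by omega)
      have e2 := m2 (by omega)
      exact ⟨θ + 1, Or.inr (Or.inr (Or.inr (Or.inr (Or.inr (Or.inr (Or.inl (by omega))))))),
        Or.inr (Or.inl (by omega))⟩
  have wait₂' : b t + 1 = d → d + n ≤ a t + 1 + l₂ → a t + 1 ≤ d + l₁ →
      θ + n = a t + l₁ + l₂ → C := by
    intro h1 h2 h3 h4
    by_cases h5 : a t + 1 = d + l₁
    · exact free₁ (by omega) (by omega) h4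
    · have e1 := m1 (by omega)
      have e2 := s2 (by omega)
      exact ⟨θ + 1, Or.inr (Or.inr (Or.inr (Or.inr (Or.inr (Or.inl (by omega)))))),
        Or.inr (Or.inl (by omega))⟩
  have free₂' : a t + l₂ = b t + n → d ≤ a t → b t < d → θ + n = a t + l₁ + l₂ → C := by
    intro h1 h2 h3 h4
    by_cases h5 : b t + 1 = d
    · exact wait₂' h5 (by omega) (by omega) h4
    · have e1 := m1 (by omega)
      have e2 := m2 (by omega)
      exact ⟨θ + 1, Or.inr (Or.inr (Or.inr (Or.inr (Or.inl (by omega))))),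
        Or.inr (Or.inl (by omega))⟩
  have wait₁' : a t + 1 = d → d ≤ b t + l₁ + 1 → b t + n + 1 ≤ d + l₂ → θ = b t + l₁ → C := by
    intro h1 h2 h3 h4
    have e2 := m2 (by omega)
    by_cases h5 : b t + n + 1 = d + l₂
    · have e1 := m1 (by omega)
      exact ⟨θ + 1, Or.inr (Or.inr (Or.inr (Or.inr (Or.inl (by omega))))),
        Or.inr (Or.inl (by omega))⟩
    · have e1 := s1 (by omega)
      exact ⟨θ + 1, Or.inr (Or.inr (Or.inr (Or.inl (by omega)))), Or.inl (by omega)⟩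
  have wait₂ : b t + 1 = n → n ≤ a t + 1 + l₂ → a t + 1 ≤ l₁ → θ = a t → C := by
    intro h1 h2 h3 h4
    by_cases h5 : a t + 1 = l₁
    · have e2 := m2 (by omega)
      by_cases h6 : l₁ = d
      · have e1 := s1 (by omega)
        exact ⟨θ + 1, Or.inr (Or.inr (Or.inr (Or.inl (by omega)))), Or.inl (by omega)⟩
      · have e1 := m1 (by omega)
        exact ⟨θ + 1, Or.inr (Or.inr (Or.inl (by omega))), Or.inr (Or.inl (by omega))⟩
    · have e1 := m1 (by omega)
      have e2 := s2 (by omega)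
      exact ⟨θ + 1, Or.inr (Or.inl (by omega)), Or.inr (Or.inl (by omega))⟩
  rcases H with ⟨h1, h2⟩ | ⟨h1, h2, h3, h4⟩ | ⟨h1, h2, h3⟩ | ⟨h1, h2, h3, h4⟩ |
    ⟨h1, h2, h3, h4⟩ | ⟨h1, h2, h3, h4⟩ | ⟨h1, h2, h3⟩ | ⟨h1, h2, h3, h4⟩
  · by_cases h5 : b t + 1 = n
    · exact wait₂ h5 (by omega) (by omega) h2
    · have e1 := m1 (by omega)
      have e2 := m2 (by omega)
      exact ⟨θ + 1, Or.inl (by omega), Or.inr (Or.inl (by omega))⟩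
  · exact wait₂ h1 h2 h3 h4
  · by_cases h5 : a t + 1 = d
    · exact wait₁' h5 (by omega) (by omega) (by omega)
    · have e1 := m1 (by omega)
      have e2 := m2 (by omega)
      exact ⟨θ + 1, Or.inr (Or.inr (Or.inl (by omega))), Or.inr (Or.inl (by omega))⟩
  · exact wait₁' h1 h2 h3 h4
  · exact free₂' h1 h2 h3 h4
  · exact wait₂' h1 h2 h3 h4
  · exact free₁ h1 h2 h3
  · exact wait₁ h1 h2 h3 h4

theorem exists_collapse (o : IsOrbit n d l₁ l₂ a b h₁ h₂) (hdn : 2 * d ≤ n) (hd : 0 < d)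
    (hl₁ : l₁ < n) (hl₂ : l₂ < n) (hc₁ : d < l₁) (hc₂ : n < l₂ + d) :
    ∃ t, Blocked1 n d l₂ (a t) (b t) ∧ Blocked2 n d l₁ (a t) (b t) := by
  have ha := o.lt₁
  have hb := o.lt₂
  have m1 := fun t => o.move₁ (t := t)
  have m2 := fun t => o.move₂ (t := t)
  have s1 := fun t => o.stay₁ (t := t)
  have s2 := fun t => o.stay₂ (t := t)
  obtain ⟨t₀, ht₀⟩ := o.exists_blocked hl₁ hl₂ (by omega)
  simp only [Blocked1, Blocked2] at m1 m2 s1 s2 ht₀ ⊢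
  set C : Prop := ∃ t, _
  have wait₂_low : ∀ k t, b t + 1 = n → a t + k + 1 = d → C := by
    intro k
    induction k with
    | zero =>
      intro t h1 h2
      exact ⟨t, by omega, by omega⟩
    | succ k ih =>
      intro t h1 h2
      have := ha t
      have := hb t
      have e1 := m1 t (by omega)
      have e2 := s2 t (by omega)
      exact ih (t + 1) (by omega) (by omega)
  have wait₁_high' : ∀ k t, a t + 1 = d → (d ≤ b t ∧ b t + k + 1 = n) → C := by
    intro k
    induction k with
    | zero =>
      intro t h1 h2
      exact ⟨t, by omega, by omega⟩
    | succ k ih =>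
      intro t h1 h2
      have := ha t
      have := hb t
      have e1 := s1 t (by omega)
      have e2 := m2 t (by omega)
      exact ih (t + 1) (by omega) (by omega)
  have free_top : ∀ k t, a t + l₂ = b t → b t + k + 1 = n → C := by
    intro k
    induction k with
    | zero =>
      intro t h1 h2
      exact wait₂_low (d - a t - 1) t h2 (by omega)
    | succ k ih =>
      intro t h1 h2
      have := ha t
      have := hb t
      have e1 := m1 t (by omega)
      have e2 := m2 t (by omega)
      exact ih (t + 1) (by omega) (by omega)
  have wait₁ : ∀ k t, a t + 1 = n → b t + k + 1 = l₂ → C := by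
    intro k
    induction k with
    | zero =>
      intro t h1 h2
      have := ha t
      have := hb t
      have e1 := m1 t (by omega)
      have e2 := m2 t (by omega)
      exact free_top (n - b (t + 1) - 1) (t + 1) (by omega) (by omega)
    | succ k ih =>
      intro t h1 h2
      have := ha t
      have := hb t
      by_cases h5 : b t + 1 = d ∧ n < l₁ + d
      · exact ⟨t, by omega, by omega⟩
      have e1 := s1 t (by omega)
      have e2 := m2 t (by omega)
      exact ih (t + 1) (by omega) (by omega)
  have free_right : ∀ k t, b t + l₁ = a t → a t + k + 1 = n → C := by
    intro k
    induction k with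
    | zero =>
      intro t h1 h2
      exact wait₁ (l₂ - b t - 1) t h2 (by omega)
    | succ k ih =>
      intro t h1 h2
      have := ha t
      have := hb t
      have e1 := m1 t (by omega)
      have e2 := m2 t (by omega)
      exact ih (t + 1) (by omega) (by omega)
  have wait₂_high : ∀ k t, b t + 1 = n → (d ≤ a t ∧ a t + k + 1 = l₁) → C := by
    intro k
    induction k with
    | zero =>
      intro t h1 h2
      have := ha t
      have := hb t
      have e1 := m1 t (by omega)
      have e2 := m2 t (by omega)
      exact free_right (n - a (t + 1) - 1) (t + 1) (by omega) (by omega)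
    | succ k ih =>
      intro t h1 h2
      have := ha t
      have := hb t
      have e1 := m1 t (by omega)
      have e2 := s2 t (by omega)
      exact ih (t + 1) (by omega) (by omega)
  have wait₂_high' : ∀ k t, b t + 1 = d → (d ≤ a t + 1 ∧ a t + 1 ≤ d + l₁ ∧ a t + k + 1 = n) → C := by
    intro k
    induction k with
    | zero =>
      intro t h1 h2
      by_cases h5 : a t + 1 = d + l₁
      · exact free_right (n - a t - 1) t (by omega) (by omega)
      · exact ⟨t, by omega, by omega⟩
    | succ k ih =>
      intro t h1 h2
      have := ha t
      have := hb t
      by_cases h5 : a t + 1 = d + l₁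
      · exact free_right (n - a t - 1) t (by omega) (by omega)
      have e1 := m1 t (by omega)
      have e2 := s2 t (by omega)
      exact ih (t + 1) (by omega) (by omega)
  have free_top' : ∀ k t, (a t + l₂ = b t + n ∧ d ≤ a t) → b t + k + 1 = d → C := by
    intro k
    induction k with
    | zero =>
      intro t h1 h2
      exact wait₂_high' (n - a t - 1) t (by omega) (by have := ha t; omega)
    | succ k ih =>
      intro t h1 h2
      have := ha t
      have := hb t
      have e1 := m1 t (by omega)
      have e2 := m2 t (by omega)
      exact ih (t + 1) (by omega) (by omega)
  have wait₁_low' : ∀ k t, a t + 1 = d → b t + n + k + 1 = d + l₂ → C := by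
    intro k
    induction k with
    | zero =>
      intro t h1 h2
      have := ha t
      have := hb t
      have e1 := m1 t (by omega)
      have e2 := m2 t (by omega)
      exact free_top' (d - b (t + 1) - 1) (t + 1) (by omega) (by omega)
    | succ k ih =>
      intro t h1 h2
      have := ha t
      have := hb t
      have e1 := s1 t (by omega)
      have e2 := m2 t (by omega)
      exact ih (t + 1) (by omega) (by omega)
  have free_right' : ∀ k t, (b t + l₁ = a t + n ∧ d ≤ b t) → a t + k + 1 = d → C := by
    intro k
    induction k with
    | zero =>
      intro t h1 h2
      exact wait₁_high' (n - b t - 1) t (by omega) (by have := hb t; omega)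
    | succ k ih =>
      intro t h1 h2
      have := ha t
      have := hb t
      have e1 := m1 t (by omega)
      have e2 := m2 t (by omega)
      exact ih (t + 1) (by omega) (by omega)
  have wait₂_low' : ∀ k t, b t + 1 = d → a t + n + k + 1 = d + l₁ → C := by
    intro k
    induction k with
    | zero =>
      intro t h1 h2
      have := ha t
      have := hb t
      have e1 := m1 t (by omega)
      have e2 := m2 t (by omega)
      exact free_right' (d - a (t + 1) - 1) (t + 1) (by omega) (by omega)
    | succ k ih =>
      intro t h1 h2
      have := ha t
      have := hb t
      have e1 := m1 t (by omega)
      have e2 := s2 t (by omega)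
      exact ih (t + 1) (by omega) (by omega)
  have := ha t₀
  have := hb t₀
  rcases ht₀ with (⟨h1, h2⟩ | ⟨h1, h2 | h2⟩) | (⟨h1, h2⟩ | ⟨h1, h2 | h2⟩ | ⟨h1, h2⟩ | ⟨h1, h2⟩)
  · exact wait₁ (l₂ - b t₀ - 1) t₀ h1 (by omega)
  · exact wait₁_high' (n - b t₀ - 1) t₀ h1 (by omega)
  · exact wait₁_low' (d + l₂ - b t₀ - 1 - n) t₀ h1 (by omega)
  · by_cases h3 : a t₀ < d
    · exact wait₂_low (d - a t₀ - 1) t₀ h1 (by omega)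
    · exact wait₂_high (l₁ - a t₀ - 1) t₀ h1 (by omega)
  · exact wait₂_high' (n - a t₀ - 1) t₀ h1 (by omega)
  · exact wait₂_low' (d + l₁ - a t₀ - 1 - n) t₀ h1 (by omega)
  · have e1 := m1 t₀ (by omega)
    have e2 := s2 t₀ (by omega)
    exact wait₂_low (d - 1) (t₀ + 1) (by omega) (by omega)
  · exact wait₂_high' (n - a t₀ - 1) t₀ h2 (by omega)

theorem hasSlope_of_collapse (o : IsOrbit n d l₁ l₂ a b h₁ h₂) {k : ℕ}
    (h : Blocked1 n d l₂ (a k) (b k) ∧ Blocked2 n d l₁ (a k) (b k)) :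
    HasSlope 0 1 h₁ ∧ HasSlope 0 1 h₂ := by
  have key : ∀ t, k ≤ t → a t = a k ∧ b t = b k ∧ h₁ t = h₁ k ∧ h₂ t = h₂ k := by
    intro t ht
    induction t, ht using Nat.le_induction with
    | base => simp
    | succ t ht ih =>
      obtain ⟨i1, i2, i3, i4⟩ := ih
      rw [← i1, ← i2] at h
      have e1 := o.stay₁ h.1
      have e2 := o.stay₂ h.2
      omega
  refine ⟨⟨k, h₁ k, fun t ht => ?_⟩, ⟨k, h₂ k, fun t ht => ?_⟩⟩
  all_goals
    have := key t ht
    rw [abs_le]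
    omega

theorem hasSlope_of_revolution (o : IsOrbit n d l₁ l₂ a b h₁ h₂) (hdn : 2 * d ≤ n)
    (hd : 0 < d) (hl₁ : 0 < l₁) (hl₁₂ : l₁ ≤ l₂) (hl₂ : l₂ < n) (hc : l₁ ≤ d ∨ l₂ + d ≤ n)
    {P : ℕ} (h : HasSlope n P h₁) : HasSlope n P h₁ ∧ HasSlope n P h₂ := by
  refine ⟨h, h.of_dist_le (Int.natCast_nonneg P) (o.dist_le (k := 0) hdn hd hl₁ (by omega) hl₂ ?_)⟩
  intro t _
  simp only [Blocked1, Blocked2]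
  omega

/-- All orbits have the same slope. -/
theorem exists_hasSlope (hdn : 2 * d ≤ n) (hd : 0 < d) (hl₁ : 0 < l₁) (hl₁₂ : l₁ ≤ l₂)
    (hl₂ : l₂ < n) : ∃ p q : ℤ, 0 < q ∧ ∀ a b h₁ h₂ : ℕ → ℕ, IsOrbit n d l₁ l₂ a b h₁ h₂ →
      HasSlope p q h₁ ∧ HasSlope p q h₂ := by
  by_cases h : l₁ + l₂ ≤ n
  · exact ⟨1, 1, one_pos, fun a b h₁ h₂ o => o.hasSlope_of_add_le hdn hd hl₁ hl₁₂ hl₂ h⟩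
  push Not at h
  by_cases hc₁ : l₁ ≤ d
  · refine ⟨n, (2 * l₁ + 2 * l₂ - n : ℕ), by omega, fun a b h₁ h₂ o =>
      o.hasSlope_of_revolution hdn hd hl₁ hl₁₂ hl₂ (Or.inl hc₁) ?_⟩
    obtain ⟨k, hk⟩ := o.exists_corner hdn hd hl₁ hl₁₂ hl₂ h (by omega) (Or.inl hc₁)
    obtain ⟨θ, hθ⟩ : ∃ θ, ShortCycle n d l₁ l₂ (a k) (b k) θ := by
      have := o.lt₂ k
      rcases hk with hk | hk | hk | hk
      · exact ⟨b k + 2 * l₁ + l₂ - n,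
          Or.inr (Or.inr (Or.inr (Or.inr (Or.inr (Or.inr (Or.inr (by omega)))))))⟩
      · exact ⟨b k + l₁, Or.inr (Or.inr (Or.inr (Or.inl (by omega))))⟩
      · exact ⟨a k, Or.inr (Or.inl (by omega))⟩
      · exact ⟨a k + l₁ + l₂ - n,
          Or.inr (Or.inr (Or.inr (Or.inr (Or.inr (Or.inl (by omega))))))⟩
    refine hasSlope_of_phase (R := fun t => ShortCycle n d l₁ l₂ (a t) (b t)) o.lt₁ hθ ?_
      (o.shortCycle_step hdn hl₁ hl₂ h hc₁)
    intro t θ hR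
    have := o.lt₁ t
    have := o.lt₂ t
    simp only [ShortCycle] at hR
    omega
  push Not at hc₁
  by_cases hc₂ : l₂ + d ≤ n
  · refine ⟨n, (l₁ + l₂ : ℕ), by omega, fun a b h₁ h₂ o =>
      o.hasSlope_of_revolution hdn hd hl₁ hl₁₂ hl₂ (Or.inr hc₂) ?_⟩
    obtain ⟨k, hk⟩ := o.exists_corner hdn hd hl₁ hl₁₂ hl₂ h (by omega) (Or.inr hc₂)
    obtain ⟨θ, hθ⟩ : ∃ θ, LongCycle n l₁ l₂ (a k) (b k) θ := by
      rcases hk with hk | hk | hk | hk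
      · exact ⟨b k + l₁, Or.inr (Or.inr (Or.inr (by omega)))⟩
      · exact ⟨a k, Or.inl (by omega)⟩
      · exact ⟨a k, Or.inr (Or.inl (by omega))⟩
      · exact ⟨a k, Or.inr (Or.inr (Or.inl (by omega)))⟩
    refine hasSlope_of_phase (R := fun t => LongCycle n l₁ l₂ (a t) (b t)) o.lt₁ hθ ?_
      (o.longCycle_step hdn hd hl₁₂ hl₂ h hc₁ hc₂)
    intro t θ hR
    have := o.lt₁ t
    have := o.lt₂ t
    simp only [LongCycle] at hR
    omega
  · refine ⟨0, 1, one_pos, fun a b h₁ h₂ o => ?_⟩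
    obtain ⟨k, hk⟩ := o.exists_collapse hdn hd (by omega) hl₂ hc₁ (by omega)
    exact o.hasSlope_of_collapse hk

end IsOrbit

section ZModCells

variable {n : ℕ} [NeZero n]

theorem atNode1_iff (x : ZMod n) : AtNode1 n x ↔ x.val + 1 = n := by
  have hx := x.val_lt
  obtain ⟨m, rfl⟩ := Nat.exists_eq_succ_of_ne_zero (NeZero.ne n)
  rw [AtNode1, ← (ZMod.val_injective _).eq_iff, ZMod.val_neg_one]
  omega

theorem atNode2_iff {d : ℕ} (hd : 0 < d) (hdn : d < n) (x : ZMod n) :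
    AtNode2 n d x ↔ x.val + 1 = d := by
  have h : (d : ZMod n) - 1 = ((d - 1 : ℕ) : ZMod n) := by
    rw [Nat.cast_sub hd, Nat.cast_one]
  rw [AtNode2, h, ← (ZMod.val_injective _).eq_iff, ZMod.val_natCast_of_lt (by omega)]
  omega

theorem occupiesNode1_iff {l : ℕ} (hl : l < n) (x : ZMod n) :
    OccupiesNode1 n l x ↔ x.val + 2 ≤ l := by
  constructor
  · rintro ⟨k, hk, rfl⟩
    rwa [ZMod.val_natCast_of_lt (by omega)]
  · exact fun h => ⟨x.val, h, (ZMod.natCast_rightInverse x).symm⟩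

theorem occupiesNode2_iff {d l : ℕ} (hdn : d < n) (hl : l < n) (x : ZMod n) :
    OccupiesNode2 n d l x ↔ d ≤ x.val ∧ x.val + 2 ≤ d + l ∨ x.val + n + 2 ≤ d + l := by
  constructor
  · rintro ⟨k, hk, rfl⟩
    rw [ZMod.val_natCast]
    rcases lt_or_ge (d + k) n with h | h
    · rw [Nat.mod_eq_of_lt h]
      omega
    · rw [Nat.mod_eq_sub_mod h, Nat.mod_eq_of_lt (by omega)]
      omega
  · rintro (⟨h1, h2⟩ | h)
    · refine ⟨x.val - d, by omega, ?_⟩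
      rw [Nat.add_sub_cancel' h1]
      exact (ZMod.natCast_rightInverse x).symm
    · have hx := x.val_lt
      refine ⟨x.val + n - d, by omega, ?_⟩
      rw [Nat.add_sub_cancel' (by omega), Nat.cast_add, ZMod.natCast_self, add_zero]
      exact (ZMod.natCast_rightInverse x).symm

theorem val_add_one_cases (hn : 1 < n) (x : ZMod n) :
    x.val + 1 < n ∧ (x + 1).val = x.val + 1 ∨ x.val + 1 = n ∧ (x + 1).val = 0 := by
  have : Fact (1 < n) := ⟨hn⟩
  have hx := x.val_lt
  rw [ZMod.val_add, ZMod.val_one]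
  rcases lt_or_eq_of_le (Nat.succ_le_of_lt hx) with h | h
  · exact Or.inl ⟨h, Nat.mod_eq_of_lt h⟩
  · refine Or.inr ⟨h, ?_⟩
    rw [show x.val + 1 = n from h, Nat.mod_self]

theorem not_moves1_iff {d l₂ : ℕ} (hd : 0 < d) (hdn : d < n) (hl₂ : l₂ < n) (x : TCState n) :
    ¬ Moves1 n d l₂ x ↔ Blocked1 n d l₂ x.1.val x.2.val := by
  rw [Moves1, not_not, atNode1_iff, atNode2_iff hd hdn, occupiesNode1_iff hl₂,
    occupiesNode2_iff hdn hl₂, Blocked1]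

theorem not_moves2_iff {d l₁ : ℕ} (hd : 0 < d) (hdn : d < n) (hl₁ : l₁ < n) (x : TCState n) :
    ¬ Moves2 n d l₁ x ↔ Blocked2 n d l₁ x.1.val x.2.val := by
  rw [Moves2, not_not, atNode1_iff, atNode2_iff hd hdn, occupiesNode1_iff hl₁,
    occupiesNode2_iff hdn hl₁, atNode1_iff, atNode2_iff hd hdn, Blocked2]

theorem isOrbit_traj {d l₁ l₂ : ℕ} (hd : 0 < d) (hdn : d < n) (hl₁ : l₁ < n) (hl₂ : l₂ < n)
    (x0 : TCState n) :
    IsOrbit n d l₁ l₂ (fun t => (traj n d l₁ l₂ x0 t).1.val)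
      (fun t => (traj n d l₁ l₂ x0 t).2.val) (H1 n d l₁ l₂ x0) (H2 n d l₁ l₂ x0) where
  lt₁ t := ZMod.val_lt _
  lt₂ t := ZMod.val_lt _
  zero₁ := by simp [H1]
  zero₂ := by simp [H2]
  step₁ t := by
    have hstep : traj n d l₁ l₂ x0 (t + 1) = tcStep n d l₁ l₂ (traj n d l₁ l₂ x0 t) :=
      Function.iterate_succ_apply' _ _ _
    rw [hstep, CellStep, ← not_moves1_iff hd hdn hl₂, H1, H1, Finset.range_add_one,
      Finset.filter_insert]
    by_cases h : Moves1 n d l₂ (traj n d l₁ l₂ x0 t)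
    · simpa [tcStep, h] using val_add_one_cases (by omega) (traj n d l₁ l₂ x0 t).1
    · simp [tcStep, h]
  step₂ t := by
    have hstep : traj n d l₁ l₂ x0 (t + 1) = tcStep n d l₁ l₂ (traj n d l₁ l₂ x0 t) :=
      Function.iterate_succ_apply' _ _ _
    rw [hstep, CellStep, ← not_moves2_iff hd hdn hl₁, H2, H2, Finset.range_add_one,
      Finset.filter_insert]
    by_cases h : Moves2 n d l₁ (traj n d l₁ l₂ x0 t)
    · simpa [tcStep, h] using val_add_one_cases (by omega) (traj n d l₁ l₂ x0 t).2
    · simp [tcStep, h]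

end ZModCells

/-- For all admissible parameters and every admissible initial state, the
average velocities of both clusters exist, are equal, and do not depend on the
initial state. -/
theorem velocities_equal_and_independent (n d l₁ l₂ : ℕ)
    (hd : 0 < d) (hdn : 2 * d ≤ n) (hl₁ : 0 < l₁) (hl₁₂ : l₁ ≤ l₂) (hl₂ : l₂ < n) :
    ∃ v : ℝ, ∀ x0 : TCState n, Admissible n d l₁ l₂ x0 →
      Tendsto (fun t : ℕ => (H1 n d l₁ l₂ x0 t : ℝ) / t) atTop (nhds v) ∧
      Tendsto (fun t : ℕ => (H2 n d l₁ l₂ x0 t : ℝ) / t) atTop (nhds v) := by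
  have : NeZero n := ⟨by omega⟩
  obtain ⟨p, q, hq, h⟩ := IsOrbit.exists_hasSlope hdn hd hl₁ hl₁₂ hl₂
  refine ⟨(p : ℝ) / q, fun x0 _ => ?_⟩
  have hx := h _ _ _ _ (isOrbit_traj hd (by omega) (by omega) hl₂ x0)
  exact ⟨hx.1.tendsto hq, hx.2.tendsto hq⟩
end

section
/- If l₁ + l₂ ≤ n, then starting from the state (l₁ mod n, 0) the system is in free movement from time 0, and the trajectory is periodic with period n: x(t + n) = x(t) for all t ≥ 0; in particular the states (l₁, 0), (0, l₂), (d + l₁, d), (d, d + l₂) (coordinates mod n) that occur on this trajectory are states of free movement. -/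
open Filter

theorem ZMod.natCast_ne_zero_of_pos_of_lt {n m : ℕ} (hm : 0 < m) (hmn : m < n) :
    (m : ZMod n) ≠ 0 := fun h =>
  Nat.not_dvd_of_pos_of_lt hm hmn ((ZMod.natCast_eq_zero_iff m n).1 h)

/-- Cluster 1 moves if it is ahead of cluster 2 by `l₁` cells. -/
theorem moves1_of_fst_eq_add {n d l₁ l₂ : ℕ} (hl₁ : 0 < l₁) (h : l₁ + l₂ ≤ n)
    {x : TCState n} (hx : x.1 = l₁ + x.2) : Moves1 n d l₂ x := by
  have key : ∀ k : ℕ, k + 2 ≤ l₂ → x.2 ≠ x.1 + 1 + k := fun k hk h₂ => by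
    refine ZMod.natCast_ne_zero_of_pos_of_lt (n := n) (m := l₁ + k + 1) (by omega) (by omega) ?_
    push_cast
    linear_combination -hx - h₂
  rintro (⟨h₁, k, hk, h₂⟩ | ⟨h₁, k, hk, h₂⟩)
  · exact key k hk (by rw [h₁, h₂]; ring)
  · exact key k hk (by rw [h₁, h₂]; push_cast; ring)

/-- Cluster 2 moves if cluster 1 is ahead of it by `l₁` cells. -/
theorem moves2_of_fst_eq_add {n d l₁ : ℕ} (hl₁ : 0 < l₁) (hn : l₁ < n)
    {x : TCState n} (hx : x.1 = l₁ + x.2) : Moves2 n d l₁ x := by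
  have ne : (l₁ : ZMod n) ≠ 0 := ZMod.natCast_ne_zero_of_pos_of_lt hl₁ hn
  have key : ∀ k : ℕ, k + 2 ≤ l₁ → x.1 ≠ x.2 + 1 + k := fun k hk h₂ => by
    refine ZMod.natCast_ne_zero_of_pos_of_lt (n := n) (m := l₁ - (k + 1)) (by omega) (by omega) ?_
    rw [Nat.cast_sub (by omega)]
    push_cast
    linear_combination h₂ - hx
  rintro (⟨h₁, k, hk, h₂⟩ | ⟨h₁, k, hk, h₂⟩ | ⟨h₁, h₂⟩ | ⟨h₁, h₂⟩)
  · exact key k hk (by rw [h₁, h₂]; ring)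
  · exact key k hk (by rw [h₁, h₂]; push_cast; ring)
  · exact ne (by rw [h₁, h₂] at hx; linear_combination -hx)
  · exact ne (by rw [h₁, h₂] at hx; linear_combination -hx)

theorem traj_release_state {n d l₁ l₂ : ℕ} (hl₁ : 0 < l₁) (hn : l₁ < n) (h : l₁ + l₂ ≤ n)
    (t : ℕ) : traj n d l₁ l₂ ((l₁ : ZMod n), 0) t = ((l₁ : ZMod n) + t, (t : ZMod n)) := by
  induction t with
  | zero => simp [traj]
  | succ t ih =>
    rw [traj, Function.iterate_succ_apply', ← traj, ih, tcStep,
      if_pos (moves1_of_fst_eq_add hl₁ h rfl), if_pos (moves2_of_fst_eq_add hl₁ hn rfl)]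
    push_cast
    rw [add_assoc]

/-- If `l₁ + l₂ ≤ n`, then starting from `(l₁, 0)` the system is in free movement
from time 0 and the trajectory is periodic with period `n`; in particular every
state occurring on this trajectory is a state of free movement. -/
theorem free_cycle_from_release_state (n d l₁ l₂ : ℕ)
    (hd : 0 < d) (hdn : 2 * d ≤ n) (hl₁ : 0 < l₁) (hl₁₂ : l₁ ≤ l₂) (hl₂ : l₂ < n)
    (h : l₁ + l₂ ≤ n) :
    FreeFrom n d l₁ l₂ ((l₁ : ZMod n), 0) 0 ∧
    (∀ t : ℕ, traj n d l₁ l₂ ((l₁ : ZMod n), 0) (t + n) =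
      traj n d l₁ l₂ ((l₁ : ZMod n), 0) t) := by
  have hn : l₁ < n := hl₁₂.trans_lt hl₂
  refine ⟨fun t _ => ?_, fun t => ?_⟩
  · rw [traj_release_state hl₁ hn h]
    exact ⟨moves1_of_fst_eq_add hl₁ h rfl, moves2_of_fst_eq_add hl₁ hn rfl⟩
  · simp [traj_release_state hl₁ hn h]
end
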